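/- arXiv:1805.03485 — 9 statements merged into one kernel-verified Lean document; each statement's English description precedes it below -/
import Mathlib

section
/- Let R be a commutative ring and let M be a finitely presented R-module that can be generated by n elements. If the n-th exterior power ⋀^n_R M is a free R-module of rank one, then M is a projective R-module of constant rank n; that is, M is projective and for every prime ideal p of R the localization M_p is a free R_p-module of rank n. -/
/-- If `v` spans `M`, then its exterior product spans the exterior power of degree the length of
`v`. -/
lemma exteriorPower.span_singleton_ιMulti_eq_top {R M : Type*} [CommRing R] [AddCommGroup M]
    [Module R M] {n : ℕ} {v : Fin n → M} (hv : Submodule.span R (Set.range v) = ⊤) :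
    Submodule.span R {exteriorPower.ιMulti R n v} = ⊤ := by
  rw [eq_top_iff, ← exteriorPower.ιMulti_span_of_span R n M hv, Submodule.span_le]
  rintro _ ⟨w, hw, rfl⟩
  choose σ hσ using fun i => hw (Set.mem_range_self i)
  obtain rfl : v ∘ σ = w := funext hσ
  by_cases h : Function.Injective σ
  · have hperm := (exteriorPower.ιMulti R n).map_perm v
      (Equiv.ofBijective σ (Finite.injective_iff_bijective.mp h))
    simp only [Equiv.coe_ofBijective] at hperm
    rw [hperm, SetLike.mem_coe, Units.smul_def]
    exact zsmul_mem (Submodule.mem_span_singleton_self _) _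
  · rw [(exteriorPower.ιMulti R n).map_eq_zero_of_not_injective _ fun H => h H.of_comp]
    exact zero_mem _

/-- A family `v : Fin n → M` on which some alternating map takes a unit value is linearly
independent. -/
lemma AlternatingMap.linearIndependent_of_isUnit {R M : Type*} [CommRing R] [AddCommGroup M]
    [Module R M] {n : ℕ} (φ : M [⋀^Fin n]→ₗ[R] R) {v : Fin n → M} (hv : IsUnit (φ v)) :
    LinearIndependent R v := by
  rw [Fintype.linearIndependent_iff]
  intro a ha i
  have h : φ (Function.update v i (∑ j, a j • v j)) = a i * φ v := by
    rw [φ.map_update_sum, Finset.sum_eq_single i]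
    · simp
    · intro j _ hj
      rw [φ.map_update_smul, φ.map_update_self v hj.symm, smul_zero]
    · simp
  rw [ha, φ.map_update_zero] at h
  exact hv.mul_left_eq_zero.mp h.symm

/-- Let `M` be a finitely presented module over a commutative ring `R` which can be
generated by `n` elements.  If the `n`-th exterior power `⋀^n_R M` is free of rank one,
then `M` is projective of constant rank `n`: it is projective, and for every prime ideal
`p` of `R` the localization `M_p` is a free module of rank `n` over `R_p`. -/
theorem projective_of_rank_of_exteriorPower_free_rank_one
    (R : Type*) [CommRing R] (M : Type*) [AddCommGroup M] [Module R M] (n : ℕ)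
    [Module.FinitePresentation R M]
    (hgen : ∃ f : Fin n → M, Submodule.span R (Set.range f) = ⊤)
    (hfree : Nonempty ((⋀[R]^n M) ≃ₗ[R] R)) :
    Module.Projective R M ∧
      ∀ (p : Ideal R) (_ : p.IsPrime),
        Nonempty ((LocalizedModule p.primeCompl M) ≃ₗ[Localization.AtPrime p]
          (Fin n → Localization.AtPrime p)) := by
  obtain ⟨v, hv⟩ := hgen
  obtain ⟨e⟩ := hfree
  have hunit : IsUnit (e (exteriorPower.ιMulti R n v)) := by
    have h := congrArg (Submodule.map e.toLinearMap)
      (exteriorPower.span_singleton_ιMulti_eq_top hv)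
    rw [Submodule.map_span, Set.image_singleton, Submodule.map_top, LinearEquiv.range] at h
    exact Ideal.span_singleton_eq_top.mp h
  have hli : LinearIndependent R v := AlternatingMap.linearIndependent_of_isUnit
    (e.toLinearMap.compAlternatingMap (exteriorPower.ιMulti R n)) hunit
  let b : Module.Basis (Fin n) R M := Module.Basis.mk hli hv.ge
  refine ⟨Module.Projective.of_basis b, fun p _ => ?_⟩
  exact ⟨(b.ofIsLocalizedModule (Localization.AtPrime p) p.primeCompl
    (LocalizedModule.mkLinearMap p.primeCompl M)).equivFun⟩
end

section
/- Let R be a commutative ring and let M be an R-module that can be generated by n elements. Then M is regularly n-alternate: the kernel of the antisymmetrizer a_n : M^{⊗n} → M^{⊗n} equals the kernel of the canonical projection π_n : M^{⊗n} → ⋀^n_R M. Equivalently, the natural surjection from the n-th exterior power ⋀^n_R M (the quotient of M^{⊗n} by the submodule generated by elementary tensors with two equal entries) onto the image of the antisymmetrizer is an isomorphism. -/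
open TensorProduct

/-- The antisymmetrizer `a_n : M^{⊗n} → M^{⊗n}`, sending an elementary tensor
`m₁ ⊗ ⋯ ⊗ mₙ` to `∑_{σ ∈ Σₙ} sgn(σ) m_{σ(1)} ⊗ ⋯ ⊗ m_{σ(n)}`. -/
noncomputable def antisymmetrizer (R M : Type*) [CommRing R] [AddCommGroup M] [Module R M]
    (n : ℕ) : (⨂[R]^n M) →ₗ[R] ⨂[R]^n M :=
  ∑ σ : Equiv.Perm (Fin n),
    (Equiv.Perm.sign σ : ℤ) •
      (PiTensorProduct.reindex R (fun _ : Fin n => M) σ.symm).toLinearMap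

/-- The canonical projection `π_n : M^{⊗n} → ⋀^n_R M` induced by the alternating
multilinear map `(m₁, …, mₙ) ↦ m₁ ∧ ⋯ ∧ mₙ`. -/
noncomputable def exteriorProjection (R M : Type*) [CommRing R] [AddCommGroup M] [Module R M]
    (n : ℕ) : (⨂[R]^n M) →ₗ[R] (⋀[R]^n M) :=
  LinearMap.codRestrict (⋀[R]^n M)
    (PiTensorProduct.lift (ExteriorAlgebra.ιMulti R n).toMultilinearMap)
    (fun x => by
      induction x using PiTensorProduct.induction_on with
      | smul_tprod r f =>
          simpa using Submodule.smul_mem _ r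
            (ExteriorAlgebra.ιMulti_range R n (Set.mem_range_self f))
      | add x y hx hy => simpa using Submodule.add_mem _ hx hy)

/-- An alternating map on `ι → R` indexed by `ι` is the determinant times its value at the
standard basis. -/
theorem AlternatingMap.apply_eq_basisFun_det_smul {R N ι : Type*} [CommRing R] [AddCommGroup N]
    [Module R N] [Fintype ι] [DecidableEq ι] (f : (ι → R) [⋀^ι]→ₗ[R] N) (v : ι → ι → R) :
    f v = (Pi.basisFun R ι).det v • f (Pi.basisFun R ι) := by
  have h : f = (LinearMap.toSpanSingleton R N (f (Pi.basisFun R ι))).compAlternatingMap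
      (Pi.basisFun R ι).det := by
    refine Module.Basis.ext_alternating (Pi.basisFun R ι) fun u hu => ?_
    let σ := Equiv.ofBijective u (Finite.injective_iff_bijective.mp hu)
    have hσ : (fun i => Pi.basisFun R ι (u i)) = Pi.basisFun R ι ∘ σ := rfl
    rw [hσ, LinearMap.compAlternatingMap_apply, AlternatingMap.map_perm, AlternatingMap.map_perm,
      Module.Basis.det_self]
    simp
  exact DFunLike.congr_fun h v

section

variable {R M : Type*} [CommRing R] [AddCommGroup M] [Module R M] {n : ℕ}

theorem antisymmetrizer_tprod (v : Fin n → M) :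
    antisymmetrizer R M n (PiTensorProduct.tprod R v) =
      MultilinearMap.alternatization (PiTensorProduct.tprod R) v := by
  rw [antisymmetrizer, LinearMap.sum_apply, MultilinearMap.alternatization_apply]
  refine Finset.sum_congr rfl fun σ _ => ?_
  have h : PiTensorProduct.reindex R (fun _ : Fin n => M) σ.symm (PiTensorProduct.tprod R v) =
      MultilinearMap.domDomCongr σ (PiTensorProduct.tprod R) v :=
    PiTensorProduct.reindex_tprod σ.symm v
  rw [← h]
  rcases Int.units_eq_one_or (Equiv.Perm.sign σ) with hσ | hσ
  · rw [hσ, Units.val_one, one_zsmul, one_smul]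
    rfl
  · rw [hσ, Units.val_neg, Units.val_one, neg_one_zsmul, LinearMap.neg_apply, Units.neg_smul,
      one_smul]
    rfl

theorem exteriorProjection_tprod (v : Fin n → M) :
    exteriorProjection R M n (PiTensorProduct.tprod R v) = exteriorPower.ιMulti R n v := by
  ext
  simp [exteriorProjection]

theorem ker_exteriorProjection_le_ker_antisymmetrizer :
    LinearMap.ker (exteriorProjection R M n) ≤ LinearMap.ker (antisymmetrizer R M n) := by
  have h : antisymmetrizer R M n =
      exteriorPower.alternatingMapLinearEquiv
        (MultilinearMap.alternatization (PiTensorProduct.tprod R)) ∘ₗ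
      exteriorProjection R M n := by
    ext v
    simp [antisymmetrizer_tprod, exteriorProjection_tprod]
  rw [h]
  exact LinearMap.ker_le_ker_comp _ _

/-- Contracting an antisymmetrized tensor against a tuple of algebra-valued linear maps gives a
determinant. -/
theorem lift_mkPiAlgebra_antisymmetrizer_tprod {A : Type*} [CommRing A] [Algebra R A]
    (c : Fin n → M →ₗ[R] A) (v : Fin n → M) :
    PiTensorProduct.lift ((MultilinearMap.mkPiAlgebra R (Fin n) A).compLinearMap c)
      (antisymmetrizer R M n (PiTensorProduct.tprod R v)) =
      (Matrix.of fun i j => c j (v i)).det := by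
  rw [antisymmetrizer_tprod, MultilinearMap.alternatization_apply, map_sum, Matrix.det_apply]
  refine Finset.sum_congr rfl fun σ _ => ?_
  rw [Units.smul_def, Units.smul_def, map_zsmul]
  simp [MultilinearMap.domDomCongr_apply]

variable {e : Fin n → M}

theorem exists_exteriorProjection_eq_smul (he : Submodule.span R (Set.range e) = ⊤)
    (x : ⨂[R]^n M) :
    ∃ r : R, exteriorProjection R M n x = r • exteriorPower.ιMulti R n e := by
  have hp : Function.Surjective (Fintype.linearCombination R e) := by
    rw [← LinearMap.range_eq_top, Fintype.range_linearCombination, he]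
  simp_rw [eq_comm (a := exteriorProjection R M n x), ← Submodule.mem_span_singleton]
  induction x using PiTensorProduct.induction_on with
  | smul_tprod r v =>
    rw [map_smul, exteriorProjection_tprod]
    refine Submodule.smul_mem _ r (Submodule.mem_span_singleton.mpr ?_)
    choose u hu using fun i => hp (v i)
    obtain rfl : v = fun i => Fintype.linearCombination R e (u i) := funext fun i => (hu i).symm
    have h := ((exteriorPower.ιMulti R n).compLinearMap
      (Fintype.linearCombination R e)).apply_eq_basisFun_det_smul u
    refine ⟨(Pi.basisFun R (Fin n)).det u, .trans ?_ h.symm⟩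
    congr 1
    simp [AlternatingMap.compLinearMap_apply]
  | add x y hx hy => simpa using Submodule.add_mem _ hx hy

theorem smul_ιMulti_eq_zero_of_linearCombination_eq_zero {k : Fin n → R}
    (hk : Fintype.linearCombination R e k = 0) (i : Fin n) :
    k i • exteriorPower.ιMulti R n e = 0 := by
  have h : exteriorPower.ιMulti R n (Function.update e i (Fintype.linearCombination R e k)) =
      k i • exteriorPower.ιMulti R n e := by
    rw [Fintype.linearCombination_apply, AlternatingMap.map_update_sum, Finset.sum_eq_single i]
    · simp [AlternatingMap.map_update_smul]
    · intro j _ hj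
      rw [AlternatingMap.map_update_smul, AlternatingMap.map_update_self _ _ hj.symm, smul_zero]
    · simp
  rw [← h, hk, AlternatingMap.map_update_zero]

/-- Modulo the annihilator of `e₁ ∧ ⋯ ∧ eₙ`, a generating family `e` admits dual coordinates. -/
theorem exists_dual_coordinates (he : Submodule.span R (Set.range e) = ⊤) :
    ∃ c : Fin n → M →ₗ[R] R ⧸ LinearMap.ker
        (LinearMap.toSpanSingleton R (⋀[R]^n M) (exteriorPower.ιMulti R n e)),
      ∀ i j, c j (e i) = if i = j then 1 else 0 := by
  set I : Ideal R := LinearMap.ker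
    (LinearMap.toSpanSingleton R (⋀[R]^n M) (exteriorPower.ιMulti R n e))
  have hp : Function.Surjective (Fintype.linearCombination R e) := by
    rw [← LinearMap.range_eq_top, Fintype.range_linearCombination, he]
  let q (j : Fin n) : (Fin n → R) →ₗ[R] R ⧸ I := I.mkQ ∘ₗ LinearMap.proj j
  have hq (j : Fin n) : LinearMap.ker (Fintype.linearCombination R e) ≤ LinearMap.ker (q j) := by
    intro k hk
    refine (Submodule.Quotient.mk_eq_zero I).mpr ?_
    exact smul_ιMulti_eq_zero_of_linearCombination_eq_zero hk j
  refine ⟨fun j => (LinearMap.ker (Fintype.linearCombination R e)).liftQ (q j) (hq j) ∘ₗ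
    ((Fintype.linearCombination R e).quotKerEquivOfSurjective hp).symm.toLinearMap,
    fun i j => ?_⟩
  have hi : ((Fintype.linearCombination R e).quotKerEquivOfSurjective hp).symm (e i) =
      Submodule.Quotient.mk (Pi.single i 1) := by
    rw [LinearEquiv.symm_apply_eq]
    simp [LinearMap.quotKerEquivOfSurjective_apply_mk]
  rw [LinearMap.comp_apply, LinearEquiv.coe_coe, hi]
  change Ideal.Quotient.mk I ((Pi.single i 1 : Fin n → R) j) = _
  rw [Pi.single_apply, apply_ite (Ideal.Quotient.mk I), map_one, map_zero]
  simp only [eq_comm]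

end

/-- If an `R`-module `M` is generated by `n` elements, then `M` is regularly `n`-alternate:
the kernel of the antisymmetrizer on `M^{⊗n}` coincides with the kernel of the canonical
projection `M^{⊗n} → ⋀^n_R M`. -/
theorem regularly_n_alternate_of_generated_by_n_elements
    (R M : Type*) [CommRing R] [AddCommGroup M] [Module R M] (n : ℕ)
    (hgen : ∃ f : Fin n → M, Submodule.span R (Set.range f) = ⊤) :
    LinearMap.ker (antisymmetrizer R M n) = LinearMap.ker (exteriorProjection R M n) := by
  obtain ⟨e, he⟩ := hgen
  refine le_antisymm (fun x hx => ?_) ker_exteriorProjection_le_ker_antisymmetrizer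
  obtain ⟨r, hr⟩ := exists_exteriorProjection_eq_smul he x
  obtain ⟨c, hc⟩ := exists_dual_coordinates he
  have hker : x - r • PiTensorProduct.tprod R e ∈ LinearMap.ker (antisymmetrizer R M n) := by
    apply ker_exteriorProjection_le_ker_antisymmetrizer
    rw [LinearMap.mem_ker, map_sub, map_smul, exteriorProjection_tprod, hr, sub_self]
  have hre : r • antisymmetrizer R M n (PiTensorProduct.tprod R e) = 0 := by
    rwa [LinearMap.mem_ker, map_sub, LinearMap.mem_ker.mp hx, map_smul, zero_sub,
      neg_eq_zero] at hker
  have hone : (Matrix.of fun i j => c j (e i)) = 1 := by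
    ext i j
    rw [Matrix.of_apply, hc, Matrix.one_apply]
  have hr0 := congrArg
    (PiTensorProduct.lift ((MultilinearMap.mkPiAlgebra R (Fin n) _).compLinearMap c)) hre
  rw [map_smul, lift_mkPiAlgebra_antisymmetrizer_tprod, hone, Matrix.det_one, map_zero,
    ← Algebra.algebraMap_eq_smul_one] at hr0
  rw [LinearMap.mem_ker, hr]
  exact Ideal.Quotient.eq_zero_iff_mem.mp hr0
end

section
/- Let R be a commutative domain, let n ∈ ℕ, let F be the free R-module R^n of rank n, and let T be a nonzero torsion R-module. Set M := F ⊕ T. Then the image of the antisymmetrizer a_{n+1} : M^{⊗(n+1)} → M^{⊗(n+1)} is a nonzero torsion R-module: the image is not the zero submodule, and every element of the image is annihilated by some nonzero element of R. -/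
open TensorProduct

theorem antisymmetrizer_tprod_s3 (R M : Type*) [CommRing R] [AddCommGroup M] [Module R M]
    (n : ℕ) (m : Fin n → M) :
    antisymmetrizer R M n (PiTensorProduct.tprod R m) =
      MultilinearMap.alternatization (PiTensorProduct.tprod R (s := fun _ : Fin n => M)) m := by
  rw [MultilinearMap.alternatization_apply]
  simp only [antisymmetrizer, LinearMap.sum_apply]
  refine Finset.sum_congr rfl fun σ _ => ?_
  change (Equiv.Perm.sign σ : ℤ) •
    PiTensorProduct.reindex R (fun _ : Fin n => M) σ.symm (PiTensorProduct.tprod R m) = _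
  rw [PiTensorProduct.reindex_tprod]
  rfl

/-- Alternating maps turn a linear dependency into an annihilator of their value. -/
theorem AlternatingMap.smul_eq_zero_of_sum_smul_eq_zero {R M N ι : Type*} [CommRing R]
    [AddCommGroup M] [Module R M] [AddCommGroup N] [Module R N] [Fintype ι]
    (A : M [⋀^ι]→ₗ[R] N) (m : ι → M) (d : ι → R) (h : ∑ i, d i • m i = 0) (j : ι) :
    d j • A m = 0 := by
  classical
  have key : A (Function.update m j (∑ i, d i • m i)) = d j • A m := by
    rw [A.map_update_sum, Finset.sum_eq_single j]
    · rw [A.map_update_smul, Function.update_eq_self]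
    · intro i _ hij
      rw [A.map_update_smul, A.map_update_self m (Ne.symm hij), smul_zero]
    · simp
  rw [← key, h, A.map_update_zero]

/-- Any `n + 1` elements of the direct sum of `R^n` and a torsion module are linearly
dependent. -/
theorem exists_sum_smul_eq_zero_of_prod_torsion {R : Type*} [CommRing R] [IsDomain R] (n : ℕ)
    {T : Type*} [AddCommGroup T] [Module R T] (hT : ∀ t : T, ∃ r : R, r ≠ 0 ∧ r • t = 0)
    (m : Fin (n + 1) → (Fin n → R) × T) :
    ∃ d : Fin (n + 1) → R, ∑ i, d i • m i = 0 ∧ ∃ j, d j ≠ 0 := by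
  have hdep : ¬ LinearIndependent R fun i => (m i).1 := fun h => by
    simpa using h.fintype_card_le_finrank
  obtain ⟨c, hc, j, hj⟩ := Fintype.not_linearIndependent_iff.mp hdep
  obtain ⟨r, hr, hrt⟩ := hT (∑ i, c i • (m i).2)
  refine ⟨fun i => r * c i, ?_, j, mul_ne_zero hr hj⟩
  simp only [mul_smul, ← Finset.smul_sum]
  ext1
  · simp [Prod.fst_sum, hc]
  · simpa [Prod.snd_sum] using hrt

/-- A permutation of `Fin (n + 1)` fixing all elements but the last one is trivial. -/
theorem Equiv.Perm.eq_one_of_forall_castSucc {n : ℕ} (σ : Equiv.Perm (Fin (n + 1)))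
    (h : ∀ i : Fin n, σ i.castSucc = i.castSucc) : σ = 1 := by
  ext1 i
  induction i using Fin.lastCases with
  | cast i => exact h i
  | last =>
    rcases Fin.eq_castSucc_or_eq_last (σ (Fin.last n)) with ⟨k, hk⟩ | hk
    · exact absurd (σ.injective (hk.trans (h k).symm)) (Fin.castSucc_lt_last k).ne'
    · exact hk

/-- The multilinear map sending `m₀, …, mₙ` to the product of the `i`-th coordinates of the
`mᵢ`, `i < n`, times the `T`-component of `mₙ`. -/
noncomputable def diagonalCoordinates (R : Type*) [CommRing R] (n : ℕ)
    (T : Type*) [AddCommGroup T] [Module R T] :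
    MultilinearMap R (fun _ : Fin (n + 1) => (Fin n → R) × T) T :=
  MultilinearMap.uncurryRight (M := fun _ : Fin (n + 1) => (Fin n → R) × T)
    (((MultilinearMap.mkPiAlgebra R (Fin n) R).compLinearMap fun i =>
      LinearMap.proj i ∘ₗ LinearMap.fst R (Fin n → R) T).smulRight
        (LinearMap.snd R (Fin n → R) T))

theorem diagonalCoordinates_apply (R : Type*) [CommRing R] (n : ℕ)
    (T : Type*) [AddCommGroup T] [Module R T] (m : Fin (n + 1) → (Fin n → R) × T) :
    diagonalCoordinates R n T m =
      (∏ i : Fin n, (m i.castSucc).1 i) • (m (Fin.last n)).2 := by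
  simp [diagonalCoordinates, Fin.init]

/-- Let `R` be a domain, `F = R^n` a free module of rank `n` and `T` a nonzero torsion
`R`-module.  Then the image of the antisymmetrizer `a_{n+1}` on `(F ⊕ T)^{⊗(n+1)}` is a
nonzero torsion module. -/
theorem antisymmetrizer_image_nonzero_torsion
    (R : Type*) [CommRing R] [IsDomain R] (n : ℕ)
    (T : Type*) [AddCommGroup T] [Module R T] [Nontrivial T]
    (hT : ∀ t : T, ∃ r : R, r ≠ 0 ∧ r • t = 0) :
    LinearMap.range (antisymmetrizer R ((Fin n → R) × T) (n + 1)) ≠ ⊥ ∧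
      ∀ x ∈ LinearMap.range (antisymmetrizer R ((Fin n → R) × T) (n + 1)),
        ∃ r : R, r ≠ 0 ∧ r • x = 0 := by
  refine ⟨fun hbot => ?_, ?_⟩
  · obtain ⟨t, ht⟩ := exists_ne (0 : T)
    let m : Fin (n + 1) → (Fin n → R) × T :=
      Fin.snoc (α := fun _ => (Fin n → R) × T) (fun i => (Pi.single i 1, 0)) (0, t)
    have h0 : antisymmetrizer R _ (n + 1) (PiTensorProduct.tprod R m) = 0 := by
      rw [LinearMap.range_eq_bot.mp hbot, LinearMap.zero_apply]
    apply ht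
    have h1 := congrArg (PiTensorProduct.lift (diagonalCoordinates R n T)) h0
    rw [antisymmetrizer_tprod_s3, MultilinearMap.alternatization_apply, map_sum, map_zero,
      Finset.sum_eq_single 1] at h1
    · simpa [diagonalCoordinates_apply, m] using h1
    · intro σ _ hσ
      obtain ⟨i, hi⟩ : ∃ i : Fin n, σ i.castSucc ≠ i.castSucc := by
        by_contra! h
        exact hσ (σ.eq_one_of_forall_castSucc h)
      have hz : (m (σ i.castSucc)).1 i = 0 := by
        rcases Fin.eq_castSucc_or_eq_last (σ i.castSucc) with ⟨k, hk⟩ | hk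
        · have hki : i ≠ k := fun h => hi (by rw [hk, h])
          simp [hk, m, hki]
        · simp [hk, m]
      have hp : ∏ i : Fin n, (m (σ i.castSucc)).1 i = 0 :=
        Finset.prod_eq_zero (Finset.mem_univ i) hz
      simp [diagonalCoordinates_apply, hp]
    · simp
  · rintro _ ⟨x, rfl⟩
    induction x using PiTensorProduct.induction_on with
    | smul_tprod c m =>
      obtain ⟨d, hd, j, hj⟩ := exists_sum_smul_eq_zero_of_prod_torsion n hT m
      refine ⟨d j, hj, ?_⟩
      rw [map_smul, antisymmetrizer_tprod_s3, smul_comm,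
        AlternatingMap.smul_eq_zero_of_sum_smul_eq_zero _ m d hd, smul_zero]
    | add x y hx hy =>
      obtain ⟨r, hr, hrx⟩ := hx
      obtain ⟨s, hs, hsy⟩ := hy
      refine ⟨r * s, mul_ne_zero hr hs, ?_⟩
      rw [map_add, smul_add, mul_smul, mul_smul, hsy, smul_comm, hrx, smul_zero, smul_zero,
        add_zero]
end

section
/- Let R be a commutative domain, let n ∈ ℕ, let F be the free R-module R^n of rank n, and let T be a torsion R-module. Then the (n+1)-st exterior power ⋀^{n+1}_R (F ⊕ T) is a torsion R-module: every element is annihilated by some nonzero element of R. -/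
/-- If `∑ i, c i • v i = 0`, then every coefficient `c j` annihilates the value at `v` of any
alternating map. -/
theorem AlternatingMap.smul_map_eq_zero_of_sum_smul_eq_zero
    {R M N ι : Type*} [CommRing R] [AddCommGroup M] [Module R M] [AddCommGroup N] [Module R N]
    [Fintype ι] (f : M [⋀^ι]→ₗ[R] N) {v : ι → M} {c : ι → R} (h : ∑ i, c i • v i = 0) (j : ι) :
    c j • f v = 0 := by
  classical
  have key : ∑ i, c i • f (Function.update v j (v i)) = 0 := by
    simpa [map_sum] using congrArg (f.toMultilinearMap.toLinearMap v j) h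
  rwa [Finset.sum_eq_single j
    (fun i _ hij => by rw [f.map_update_self v hij.symm, smul_zero]) (by simp),
    Function.update_eq_self] at key

/-- Let `R` be a domain, `F = R^n` a free module of rank `n` and `T` a torsion `R`-module.
Then the `(n+1)`-st exterior power `⋀^{n+1}_R (F ⊕ T)` is a torsion module: every element
is annihilated by a nonzero element of `R`. -/
theorem exteriorPower_torsion_of_free_sum_torsion
    (R : Type*) [CommRing R] [IsDomain R] (n : ℕ)
    (T : Type*) [AddCommGroup T] [Module R T]
    (hT : ∀ t : T, ∃ r : R, r ≠ 0 ∧ r • t = 0) :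
    ∀ x : ⋀[R]^(n + 1) ((Fin n → R) × T), ∃ r : R, r ≠ 0 ∧ r • x = 0 := by
  intro x
  have hx : x ∈ Submodule.span R (Set.range (exteriorPower.ιMulti R (n + 1))) := by
    rw [exteriorPower.ιMulti_span]
    exact Submodule.mem_top
  induction hx using Submodule.span_induction with
  | zero => exact ⟨1, one_ne_zero, smul_zero _⟩
  | add x y _ _ hx hy =>
    obtain ⟨r, hr, hrx⟩ := hx
    obtain ⟨s, hs, hsy⟩ := hy
    refine ⟨r * s, mul_ne_zero hr hs, ?_⟩
    rw [smul_add, mul_smul, mul_smul, hsy, smul_comm, hrx, smul_zero, smul_zero, add_zero]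
  | smul a x _ hx =>
    obtain ⟨r, hr, hrx⟩ := hx
    exact ⟨r, hr, by rw [smul_comm, hrx, smul_zero]⟩
  | mem x hx =>
    obtain ⟨v, rfl⟩ := hx
    have hdep : ¬ LinearIndependent R fun i => (v i).1 := fun hli => by
      simpa using hli.fintype_card_le_finrank
    obtain ⟨c, hc, j, hj⟩ := Fintype.not_linearIndependent_iff.mp hdep
    obtain ⟨d, hd, hdt⟩ := hT (∑ i, c i • (v i).2)
    refine ⟨d * c j, mul_ne_zero hd hj,
      (exteriorPower.ιMulti R (n + 1)).smul_map_eq_zero_of_sum_smul_eq_zero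
        (c := fun i => d * c i) ?_ j⟩
    simp_rw [mul_smul, ← Finset.smul_sum]
    ext1
    · simp [Prod.fst_sum, hc]
    · simpa [Prod.snd_sum] using hdt
end

section
/- (McCoy's theorem, multivariable version) Let B be a commutative ring and let f be a polynomial in the multivariate polynomial ring B[x₁,…,xₙ]. If f is a zero-divisor, i.e. there exists a nonzero g ∈ B[x₁,…,xₙ] with f·g = 0, then there exists a nonzero element b ∈ B with b·f = 0 (b annihilates every coefficient of f). -/
open MonomialOrder in
/-- If `g` annihilates `f` and has minimal degree among the nonzero annihilators of `f`, then
every coefficient of `f` annihilates `g`. -/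
theorem MonomialOrder.coeff_smul_eq_zero_of_mul_eq_zero_of_minimal {σ B : Type*} [CommRing B]
    (m : MonomialOrder σ) {f g : MvPolynomial σ B} (hfg : f * g = 0)
    (hmin : ∀ h : MvPolynomial σ B, h ≠ 0 → f * h = 0 → m.degree g ≼[m] m.degree h)
    (d : σ →₀ ℕ) : f.coeff d • g = 0 := by
  classical
  by_contra hd
  obtain ⟨d, hd, hmax⟩ : ∃ d, f.coeff d • g ≠ 0 ∧
      ∀ a, f.coeff a • g ≠ 0 → m.toSyn a ≤ m.toSyn d := by
    obtain ⟨d, hd, hmax⟩ := Finset.exists_max_image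
      (f.support.filter fun a => f.coeff a • g ≠ 0) m.toSyn
      ⟨d, Finset.mem_filter.2 ⟨MvPolynomial.mem_support_iff.2 fun h => hd (by simp [h]), hd⟩⟩
    exact ⟨d, (Finset.mem_filter.1 hd).2, fun a ha => hmax a <| Finset.mem_filter.2
      ⟨MvPolynomial.mem_support_iff.2 fun h => ha (by simp [h]), ha⟩⟩
  have hlead : f.coeff d * g.coeff (m.degree g) = 0 := by
    have hcoeff : (f * g).coeff (d + m.degree g) = f.coeff d * g.coeff (m.degree g) := by
      rw [MvPolynomial.coeff_mul]
      refine Finset.sum_eq_single (d, m.degree g) ?_ (by simp)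
      rintro ⟨a, b⟩ hab hne
      rw [Finset.HasAntidiagonal.mem_antidiagonal] at hab
      by_contra hprod
      have ha : m.toSyn a ≤ m.toSyn d := hmax a fun h =>
        hprod (by simpa using congrArg (MvPolynomial.coeff b) h)
      have hb : m.toSyn b ≤ m.toSyn (m.degree g) := m.le_degree <|
        MvPolynomial.mem_support_iff.2 fun h => hprod (by simp [h])
      have hsum : m.toSyn a + m.toSyn b = m.toSyn d + m.toSyn (m.degree g) := by
        simpa using congrArg m.toSyn hab
      obtain ⟨had, hbg⟩ := (add_eq_add_iff_eq_and_eq ha hb).1 hsum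
      exact hne (Prod.ext (m.toSyn.injective had) (m.toSyn.injective hbg))
    rw [← hcoeff, hfg, MvPolynomial.coeff_zero]
  have hle : m.degree (f.coeff d • g) ≼[m] m.degree g := m.degree_smul_le
  have hdeg : m.degree (f.coeff d • g) = m.degree g := m.toSyn.injective <|
    le_antisymm hle (hmin _ hd (by rw [mul_smul_comm, hfg, smul_zero]))
  refine m.leadingCoeff_ne_zero_iff.2 hd ?_
  rw [MonomialOrder.leadingCoeff, hdeg, MvPolynomial.coeff_smul, smul_eq_mul, hlead]

/-- McCoy's theorem (multivariable version): if a polynomial `f` in `n` variables over a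
commutative ring `B` is a zero-divisor, then `f` is annihilated by a nonzero constant
`b ∈ B`. -/
theorem mccoy_mvPolynomial
    (B : Type*) [CommRing B] (n : ℕ) (f : MvPolynomial (Fin n) B)
    (hf : ∃ g : MvPolynomial (Fin n) B, g ≠ 0 ∧ f * g = 0) :
    ∃ b : B, b ≠ 0 ∧ b • f = 0 := by
  let m : MonomialOrder (Fin n) := MonomialOrder.lex
  let s : Set (MvPolynomial (Fin n) B) := {g | g ≠ 0 ∧ f * g = 0}
  have hwf : WellFounded fun g h : MvPolynomial (Fin n) B =>
      m.toSyn (m.degree g) < m.toSyn (m.degree h) := InvImage.wf _ wellFounded_lt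
  obtain ⟨g, ⟨hg, hfg⟩, hmin⟩ := hwf.has_min s hf
  refine ⟨m.leadingCoeff g, m.leadingCoeff_ne_zero_iff.2 hg, MvPolynomial.ext _ _ fun d => ?_⟩
  have hd := m.coeff_smul_eq_zero_of_mul_eq_zero_of_minimal hfg
    (fun h hh hfh => not_lt.1 (hmin h ⟨hh, hfh⟩)) d
  simpa [MonomialOrder.leadingCoeff, mul_comm] using
    congrArg (MvPolynomial.coeff (m.degree g)) hd
end

section
/- Let (R, 𝔪) be a commutative local ring and let M be a finitely generated R-module. Let k be the dimension of the quotient M/𝔪M as a vector space over the residue field R/𝔪. Then the k-th exterior power ⋀^k_R M is a nonzero cyclic R-module: it is generated by a single element and is not the zero module. -/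
namespace IsLocalRing

variable {R M : Type*} [CommRing R] [IsLocalRing R] [AddCommGroup M] [Module R M]

/-- **Nakayama**: lifts of a spanning family of `M/𝔪M` span `M`. -/
lemma span_range_eq_top_of_span_range_mkQ_eq_top [Module.Finite R M] {ι : Type*} (v : ι → M)
    (hv : Submodule.span (R ⧸ maximalIdeal R)
      (Set.range fun i ↦ (maximalIdeal R • ⊤ : Submodule R M).mkQ (v i)) = ⊤) :
    Submodule.span R (Set.range v) = ⊤ := by
  rw [← map_mkQ_eq_top, Submodule.map_span, ← Set.range_comp]
  rw [← Submodule.restrictScalars_eq_top_iff R,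
    Submodule.restrictScalars_span R (R ⧸ maximalIdeal R) Ideal.Quotient.mk_surjective] at hv
  exact hv

end IsLocalRing

namespace exteriorPower

variable {R M : Type*} [CommRing R] [AddCommGroup M] [Module R M]

/-- If `M` is spanned by `n` elements, then `⋀^n M` is spanned by their wedge product. -/
lemma span_singleton_ιMulti_eq_top_s7 {n : ℕ} {v : Fin n → M}
    (hv : Submodule.span R (Set.range v) = ⊤) :
    Submodule.span R {ιMulti R n v} = ⊤ := by
  rw [eq_top_iff, ← ιMulti_family_span_of_span R hv, Submodule.span_le]
  rintro _ ⟨s, rfl⟩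
  have h : Set.powersetCard.ofFinEmbEquiv.symm s = RelEmbedding.refl _ := by
    have hs := Finite.surjective_of_injective (Set.powersetCard.ofFinEmbEquiv.symm s).injective
    rw [← OrderEmbedding.range_inj, hs.range_eq]
    exact Set.range_id.symm
  simp [ιMulti_family, h]

end exteriorPower

/-- Let `(R, 𝔪)` be a commutative local ring and `M` a finitely generated `R`-module.
If `k` is the dimension of `M/𝔪M` as a vector space over the residue field `R/𝔪`, then
the `k`-th exterior power `⋀^k_R M` is a nonzero cyclic `R`-module. -/
theorem exteriorPower_minimal_generators_cyclic_nonzero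
    (R : Type*) [CommRing R] [IsLocalRing R]
    (M : Type*) [AddCommGroup M] [Module R M] [Module.Finite R M]
    (k : ℕ)
    (hk : k = Module.finrank (R ⧸ IsLocalRing.maximalIdeal R)
      (M ⧸ (IsLocalRing.maximalIdeal R • ⊤ : Submodule R M))) :
    (∃ x : ⋀[R]^k M, Submodule.span R {x} = ⊤) ∧ Nontrivial (⋀[R]^k M) := by
  let p : Submodule R M := IsLocalRing.maximalIdeal R • ⊤
  let _ : Field (R ⧸ IsLocalRing.maximalIdeal R) := Ideal.Quotient.field _
  have : Module.Finite (R ⧸ IsLocalRing.maximalIdeal R) (M ⧸ p) :=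
    Module.Finite.of_restrictScalars_finite R _ _
  let b := Module.finBasisOfFinrankEq (R ⧸ IsLocalRing.maximalIdeal R) (M ⧸ p) hk.symm
  choose v hv using fun i ↦ p.mkQ_surjective (b i)
  have hspan : Submodule.span R (Set.range v) = ⊤ := by
    apply IsLocalRing.span_range_eq_top_of_span_range_mkQ_eq_top
    exact (congrArg (fun f ↦ Submodule.span _ (Set.range f)) (funext hv)).trans b.span_eq
  refine ⟨⟨_, exteriorPower.span_singleton_ιMulti_eq_top_s7 hspan⟩,
    exteriorPower.ιMulti R k v, 0, fun h ↦ ?_⟩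
  let f : M [⋀^Fin k]→ₗ[R] (R ⧸ IsLocalRing.maximalIdeal R) :=
    AlternatingMap.compLinearMap
      { b.det.toMultilinearMap.restrictScalars R with
        map_eq_zero_of_eq' := b.det.map_eq_zero_of_eq' } p.mkQ
  have hf : f v = 1 := by
    change b.det (fun i ↦ p.mkQ (v i)) = 1
    rw [funext hv, b.det_self]
  rw [← exteriorPower.alternatingMapLinearEquiv_apply_ιMulti f v, h, map_zero] at hf
  exact zero_ne_one hf
end

section
/- Let R be a commutative ring which is a directed union of subrings each of which is a principal ideal domain: there is a nonempty directed family (S_i)_{i ∈ I} of subrings of R, monotone in i, whose union is all of R, such that each S_i is an integral domain in which every ideal is principal. Then every finitely presented R-module is isomorphic to a finite direct sum of cyclic R-modules, i.e., to a module of the form R/I₁ ⊕ ⋯ ⊕ R/I_m for finitely many ideals I₁,…,I_m of R. -/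
/-- The quotient of a free module by the span of multiples of the vectors of a finite basis is a
product of cyclic modules. -/
theorem Module.Basis.nonempty_quotient_span_smul_equiv_pi {ι R V : Type*} [Finite ι] [CommRing R]
    [AddCommGroup V] [Module R V] (b : Module.Basis ι R V) (d : ι → R) :
    Nonempty ((V ⧸ Submodule.span R (Set.range fun j => d j • b j)) ≃ₗ[R]
      ∀ j, R ⧸ Ideal.span {d j}) := by
  classical
  have := Fintype.ofFinite ι
  refine ⟨Submodule.Quotient.equiv _ (Submodule.pi Set.univ fun j => Ideal.span {d j})
    b.equivFun ?_ ≪≫ₗ Submodule.quotientPi _⟩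
  refine le_antisymm ?_ fun x hx => ?_
  · rw [Submodule.map_span, Submodule.span_le]
    rintro _ ⟨_, ⟨j, rfl⟩, rfl⟩ i -
    by_cases h : j = i
    · subst h
      simp
    · simp [h]
  · have hx' (j) : ∃ c, x j = d j * c := Ideal.mem_span_singleton.mp (hx j trivial)
    choose c hc using hx'
    rw [Submodule.mem_map_equiv, Module.Basis.equivFun_symm_apply]
    refine Submodule.sum_mem _ fun j _ => ?_
    rw [hc, mul_comm, mul_smul]
    exact Submodule.smul_mem _ _ (Submodule.subset_span ⟨j, rfl⟩)

/-- A quotient of `Rⁿ` by relations with entries in a principal ideal domain mapping to `R` is a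
product of cyclic modules. -/
theorem Submodule.exists_quotient_span_image_equiv_pi {A R ι : Type*} [CommRing A] [IsDomain A]
    [IsPrincipalIdealRing A] [CommRing R] [Algebra A R] [Finite ι] (N : Submodule A (ι → A)) :
    ∃ d : ι → R, Nonempty
      (((ι → R) ⧸ span R ((Algebra.linearMap A R).compLeft ι '' (N : Set (ι → A)))) ≃ₗ[R]
        ∀ j, R ⧸ Ideal.span {d j}) := by
  classical
  obtain ⟨k, s⟩ := N.smithNormalForm (Pi.basisFun A ι)
  set φ := (Algebra.linearMap A R).compLeft ι
  have hφ : IsBaseChange R φ := IsBaseChange.finitePow ι (IsBaseChange.linearMap A R)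
  let b := IsBaseChange.basis s.bM hφ
  have hb (j) : b j = φ (s.bM j) := IsBaseChange.basis_apply s.bM hφ j
  let d : ι → R := Function.extend s.f (fun i => algebraMap A R (s.a i)) 0
  have hd (i) : φ (s.bN i) = d (s.f i) • b (s.f i) := by
    simp only [d, s.snf, map_smul, hb, s.f.injective.extend_apply, algebraMap_smul]
  refine ⟨d, ?_⟩
  have hspan : span R (φ '' (N : Set (ι → A))) = span R (Set.range fun j => d j • b j) := by
    refine le_antisymm (span_le.mpr ?_) (span_le.mpr ?_)
    · rintro _ ⟨x, hx, rfl⟩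
      have hsum := congrArg (fun y : N => φ y) (s.bN.sum_repr ⟨x, hx⟩)
      simp only [AddSubmonoidClass.coe_finsetSum, SetLike.val_smul, map_sum, map_smul] at hsum
      rw [← hsum]
      refine sum_mem fun i _ => ?_
      rw [hd, ← algebraMap_smul R]
      exact smul_mem _ _ (subset_span ⟨_, rfl⟩)
    · rintro _ ⟨j, rfl⟩
      by_cases h : ∃ i, s.f i = j
      · obtain ⟨i, rfl⟩ := h
        exact subset_span ⟨s.bN i, (s.bN i).2, hd i⟩
      · simp [d, Function.extend_apply' _ _ _ h]
  obtain ⟨e⟩ := b.nonempty_quotient_span_smul_equiv_pi d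
  exact ⟨quotEquivOfEq _ _ hspan ≪≫ₗ e⟩

/-- Let `R` be a commutative ring which is the union of a nonempty directed family of
subrings, each of which is a principal ideal domain.  Then every finitely presented
`R`-module is isomorphic to a finite direct sum of cyclic modules `R ⧸ Iⱼ`. -/
theorem finitePresentation_direct_sum_cyclic_of_directed_union_of_PIDs
    (R : Type*) [CommRing R]
    (ι : Type*) [PartialOrder ι] [Nonempty ι] [IsDirected ι (· ≤ ·)]
    (S : ι → Subring R) (hmono : Monotone S)
    (hunion : ∀ r : R, ∃ i, r ∈ S i)
    (hdom : ∀ i, IsDomain (S i)) (hpir : ∀ i, IsPrincipalIdealRing (S i))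
    (M : Type*) [AddCommGroup M] [Module R M] [Module.FinitePresentation R M] :
    ∃ (m : ℕ) (I : Fin m → Ideal R), Nonempty (M ≃ₗ[R] ∀ j : Fin m, R ⧸ I j) := by
  obtain ⟨n, K, e, s, hs⟩ := Module.FinitePresentation.exists_fin R M
  choose i hi using hunion
  obtain ⟨i₀, hi₀⟩ := Finite.exists_le fun p : s × Fin n => i (p.1.1 p.2)
  have hmem (v : s) (j : Fin n) : v.1 j ∈ S i₀ := hmono (hi₀ (v, j)) (hi _)
  have := hdom i₀
  have := hpir i₀
  let φ := (Algebra.linearMap (S i₀) R).compLeft (Fin n)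
  let N : Submodule (S i₀) (Fin n → S i₀) :=
    Submodule.span _ (Set.range fun (v : s) j => ⟨v.1 j, hmem v j⟩)
  have hK : Submodule.span R (φ '' (N : Set (Fin n → S i₀))) = K := by
    have hN : φ '' (N : Set (Fin n → S i₀)) = Submodule.span (S i₀) (s : Set (Fin n → R)) := by
      rw [← Submodule.map_coe, Submodule.map_span, ← Set.range_comp]
      congr
      exact Subtype.range_coe
    rw [hN, Submodule.span_span_of_tower, hs]
  obtain ⟨d, ⟨f⟩⟩ := N.exists_quotient_span_image_equiv_pi (R := R)
  exact ⟨n, fun j => Ideal.span {d j}, ⟨e ≪≫ₗ Submodule.quotEquivOfEq _ _ hK.symm ≪≫ₗ f⟩⟩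
end

section
/- Let k ⊆ K be fields (K a field equipped with a k-algebra structure making it a field extension of k). Let S be the submonoid of the polynomial ring K[X] consisting of the images, under coefficientwise extension of scalars k[X] → K[X], of the nonzero polynomials with coefficients in k. Then the tensor product k(X) ⊗_k K, regarded as a K[X]-algebra via the map sending X to X ⊗ 1 and c ∈ K to 1 ⊗ c, is the localization of K[X] at S; in particular k(X) ⊗_k K is isomorphic to S⁻¹K[X]. -/
open TensorProduct Polynomial

variable (k K : Type*) [Field k] [Field K] [Algebra k K]

/-- The `K`-algebra structure on `k(X) ⊗_k K` coming from the right tensor factor,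
so that `c ∈ K` is sent to `1 ⊗ c`. -/
noncomputable instance ratFuncTensorAlgebraK : Algebra K (RatFunc k ⊗[k] K) :=
  Algebra.TensorProduct.rightAlgebra

/-- The `K[X]`-algebra structure on `k(X) ⊗_k K` sending `X` to `X ⊗ 1` and `c ∈ K`
to `1 ⊗ c`. -/
noncomputable instance ratFuncTensorAlgebraPolyK :
    Algebra (Polynomial K) (RatFunc k ⊗[k] K) :=
  (Polynomial.aeval ((RatFunc.X : RatFunc k) ⊗ₜ[k] (1 : K))).toAlgebra

/-- `k(X) ⊗_k K` is the localization of `K[X]` at the image of the nonzero divisors of `k[X]`,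
being the pushout of `k(X)` and `K[X]` over `k[X]`. -/
theorem ratFunc_tensor_isLocalization_map_nonZeroDivisors :
    IsLocalization ((nonZeroDivisors k[X]).map (mapRingHom (algebraMap k K)))
      (RatFunc k ⊗[k] K) := by
  let := Polynomial.algebra k K
  change IsLocalization (Algebra.algebraMapSubmonoid K[X] (nonZeroDivisors k[X])) _
  have hC (c : K) : algebraMap K[X] (RatFunc k ⊗[k] K) (C c) = 1 ⊗ₜ c :=
    Polynomial.aeval_C _ c
  have hX : algebraMap K[X] (RatFunc k ⊗[k] K) X = RatFunc.X ⊗ₜ 1 := Polynomial.aeval_X _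
  have : IsScalarTower K K[X] (RatFunc k ⊗[k] K) := .of_algebraMap_eq fun c ↦ (hC c).symm
  have : IsScalarTower k K[X] (RatFunc k ⊗[k] K) := .of_algebraMap_eq fun c ↦ by
    rw [Polynomial.algebraMap_apply, hC, ← Algebra.TensorProduct.algebraMap_apply']
  have : IsScalarTower k[X] K[X] (RatFunc k ⊗[k] K) := .of_algebraMap_eq' <| by
    ext c
    · simp [hC, Algebra.TensorProduct.algebraMap_apply, ← RatFunc.algebraMap_eq_C,
        Algebra.TensorProduct.tmul_one_eq_one_tmul]
    · simp [hX, Algebra.TensorProduct.algebraMap_apply]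
  rw [Algebra.isLocalization_iff_isPushout _ (RatFunc k), Algebra.IsPushout.comm,
    ← Algebra.IsPushout.comp_iff k _ K]
  infer_instance

/-- Let `k ⊆ K` be fields and let `S` be the submonoid of `K[X]` consisting of the images
of the nonzero polynomials with coefficients in `k`.  Then `k(X) ⊗_k K`, regarded as a
`K[X]`-algebra via `X ↦ X ⊗ 1` and `c ↦ 1 ⊗ c`, is the localization of `K[X]` at `S`;
in particular `k(X) ⊗_k K ≅ S⁻¹K[X]`. -/
theorem ratFunc_tensor_isLocalization
    (S : Submonoid (Polynomial K))
    (hS : ∀ q : Polynomial K,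
      q ∈ S ↔ ∃ p : Polynomial k, p ≠ 0 ∧ p.map (algebraMap k K) = q) :
    IsLocalization S (RatFunc k ⊗[k] K) ∧
      Nonempty ((RatFunc k ⊗[k] K) ≃ₐ[Polynomial K] Localization S) := by
  have hS' : S = (nonZeroDivisors k[X]).map (mapRingHom (algebraMap k K)) := by
    ext q
    simp [hS]
  have : IsLocalization S (RatFunc k ⊗[k] K) :=
    hS' ▸ ratFunc_tensor_isLocalization_map_nonZeroDivisors k K
  exact ⟨this, ⟨IsLocalization.algEquiv S _ _⟩⟩
end

section
/- Let k be a field, let k′ be a finite separable field extension of k, and let K be an arbitrary field extension of k. Then the tensor product k′ ⊗_k K is a semisimple ring. -/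
open TensorProduct

/-- Let `k′` be a finite separable field extension of `k` and let `K` be an arbitrary
field extension of `k`.  Then `k′ ⊗_k K` is a semisimple ring. -/
theorem tensorProduct_semisimple_of_finite_separable
    (k k' K : Type*) [Field k] [Field k'] [Field K]
    [Algebra k k'] [FiniteDimensional k k'] [Algebra.IsSeparable k k']
    [Algebra k K] :
    IsSemisimpleRing (k' ⊗[k] K) := by
  have : Algebra.FormallyUnramified k k' := .of_isSeparable k k'
  have : IsReduced (K ⊗[k] k') := Algebra.FormallyUnramified.isReduced_of_field K (K ⊗[k] k')
  have : IsArtinianRing (K ⊗[k] k') := .of_finite K (K ⊗[k] k')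
  have : IsSemisimpleRing (K ⊗[k] k') := IsArtinianRing.isSemisimpleRing_of_isReduced _
  exact (Algebra.TensorProduct.comm k K k').toRingEquiv.isSemisimpleRing
end
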